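/- arXiv:1312.3187 — 2 statements merged into one kernel-verified Lean document; each statement's English description precedes it below -/
import Mathlib

section
/- Let $R$ be a commutative integral domain of characteristic zero, let $G$ be a finite group, let $\Gamma$ be a module over the group algebra $R[G]$ that is free of finite rank as an $R$-module, and let $D$ be a field equipped with an injective ring homomorphism $R \to D$ making it an $R$-algebra. Then $\mathrm{End}_{R[G]}(\Gamma) \otimes_R D$ is a division ring if and only if $\Gamma \otimes_R D$ is a simple $D[G]$-module; here $\Gamma \otimes_R D$ carries the $D[G]$-module structure with $G$ acting on the first factor and $D$ on the second. -/
open TensorProduct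

section BaseChangeSetup

variable (R : Type) [CommRing R] (G : Type) [Group G]
  (D : Type) [Field D] [Algebra R D]
  (Γ : Type) [AddCommGroup Γ] [Module R Γ] [Module (MonoidAlgebra R G) Γ]
  [IsScalarTower R (MonoidAlgebra R G) Γ]

/-- The `R`-linear action of a group element `g : G` on an `R[G]`-module `Γ`. -/
noncomputable def gSmul (g : G) : Γ →ₗ[R] Γ where
  toFun γ := MonoidAlgebra.of R G g • γ
  map_add' x y := smul_add _ x y
  map_smul' r x := smul_comm _ r x

/-- The representation of `G` on `Γ ⊗_R D` (written as `D ⊗[R] Γ`, with `G` acting on the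
factor `Γ` and `D` acting on the factor `D`), obtained by base change. -/
noncomputable def gBaseChange : Representation D G (D ⊗[R] Γ) where
  toFun g := LinearMap.baseChange D (gSmul R G Γ g)
  map_one' := by
    have h : gSmul R G Γ (1 : G) = (1 : Module.End R Γ) := by
      ext γ
      show MonoidAlgebra.single (1 : G) (1 : R) • γ = γ
      rw [← MonoidAlgebra.one_def, one_smul]
    show LinearMap.baseChange D (gSmul R G Γ 1) = 1
    rw [h]
    exact LinearMap.baseChange_one R Γ
  map_mul' g h := by
    have hmul : gSmul R G Γ (g * h) = (gSmul R G Γ g).comp (gSmul R G Γ h) := by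
      ext γ
      show MonoidAlgebra.single (g * h) (1 : R) • γ = _
      rw [LinearMap.comp_apply]
      show _ = MonoidAlgebra.single g (1 : R) • MonoidAlgebra.single h (1 : R) • γ
      rw [← mul_smul, MonoidAlgebra.single_mul_single, one_mul]
    show LinearMap.baseChange D (gSmul R G Γ (g * h)) =
      LinearMap.baseChange D (gSmul R G Γ g) * LinearMap.baseChange D (gSmul R G Γ h)
    rw [hmul, LinearMap.baseChange_comp]
    rfl

/-- The `D[G]`-module structure on `Γ ⊗_R D` (written `D ⊗[R] Γ`), in which `G` acts on the
factor `Γ` and `D` acts on the factor `D`. -/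
noncomputable instance moduleBaseChange : Module (MonoidAlgebra D G) (D ⊗[R] Γ) :=
  Module.compHom (D ⊗[R] Γ) (gBaseChange R G D Γ).asAlgebraHom.toRingHom

noncomputable instance towerBaseChange :
    IsScalarTower D (MonoidAlgebra D G) (D ⊗[R] Γ) := by
  constructor
  intro d m v
  show (gBaseChange R G D Γ).asAlgebraHom (d • m) v =
    d • (gBaseChange R G D Γ).asAlgebraHom m v
  rw [map_smul]
  rfl

end BaseChangeSetup

attribute [local instance] Algebra.TensorProduct.rightAlgebra

section SemisimpleSchur

variable {A M : Type*} [Ring A] [AddCommGroup M] [Module A M]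

/-- A semisimple module is simple exactly when its endomorphism ring is a division ring. -/
theorem isSimpleModule_iff_end_isUnit [IsSemisimpleModule A M] :
    IsSimpleModule A M ↔
      (0 : Module.End A M) ≠ 1 ∧ ∀ f : Module.End A M, f ≠ 0 → IsUnit f := by
  constructor
  · intro _
    have := IsSimpleModule.nontrivial A M
    exact ⟨zero_ne_one, fun f hf => (Module.End.isUnit_iff f).2 (LinearMap.bijective_of_ne_zero hf)⟩
  · rintro ⟨hne, hunit⟩
    have : Nontrivial M := by
      by_contra h
      rw [not_nontrivial_iff_subsingleton] at h
      exact hne (Subsingleton.elim _ _)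
    have : IsSimpleOrder (Submodule A M) :=
      { eq_bot_or_eq_top := fun p => by
          obtain ⟨q, hpq⟩ := exists_isCompl p
          by_cases hf : p.projection q hpq = 0
          · left
            rw [← Submodule.range_projection hpq, hf, LinearMap.range_zero]
          · right
            rw [← Submodule.range_projection hpq, LinearMap.range_eq_top]
            exact ((Module.End.isUnit_iff _).1 (hunit _ hf)).2 }
    exact ⟨⟩

end SemisimpleSchur

/-- A domain embeds flatly into every field that contains it. -/
theorem Module.Flat.of_injective_algebraMap_field {R D : Type*} [CommRing R] [IsDomain R]
    [Field D] [Algebra R D] (hinj : Function.Injective (algebraMap R D)) : Module.Flat R D := by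
  have : FaithfulSMul R D := (faithfulSMul_iff_algebraMap_injective R D).2 hinj
  let _ : Algebra (FractionRing R) D := FractionRing.liftAlgebra R D
  have : Module.Flat R (FractionRing R) := IsLocalization.flat _ (nonZeroDivisors R)
  exact Module.Flat.trans R (FractionRing R) D

section EndBaseChange

variable (R : Type) [CommRing R] (G : Type) [Group G]
  (D : Type) [Field D] [Algebra R D]
  (Γ : Type) [AddCommGroup Γ] [Module R Γ] [Module (MonoidAlgebra R G) Γ]
  [IsScalarTower R (MonoidAlgebra R G) Γ]

/-- The inclusion of the `R[G]`-linear endomorphisms into the `R`-linear ones. -/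
noncomputable def endRestrictScalars : Module.End (MonoidAlgebra R G) Γ →ₐ[R] Module.End R Γ where
  toFun f := f.restrictScalars R
  map_one' := rfl
  map_mul' _ _ := rfl
  map_zero' := rfl
  map_add' _ _ := rfl
  commutes' _ := rfl

theorem endRestrictScalars_injective : Function.Injective (endRestrictScalars R G Γ) :=
  LinearMap.restrictScalars_injective R

/-- An `R`-linear endomorphism is `R[G]`-linear exactly when it commutes with `G`. -/
theorem mem_range_endRestrictScalars_iff (f : Module.End R Γ) :
    f ∈ (endRestrictScalars R G Γ).range ↔ ∀ g : G, Commute (gSmul R G Γ g) f := by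
  constructor
  · rintro ⟨f, rfl⟩ g
    ext γ
    exact (f.map_smul (MonoidAlgebra.of R G g) γ).symm
  · intro h
    exact ⟨MonoidAlgebra.equivariantOfLinearOfComm f
      fun g γ => (LinearMap.congr_fun (h g) γ).symm, rfl⟩

/-- The map sending an endomorphism to its commutators with the elements of `G`. -/
noncomputable def groupCommutator : Module.End R Γ →ₗ[R] (G → Module.End R Γ) :=
  LinearMap.pi fun g => LinearMap.mulLeft R (gSmul R G Γ g) - LinearMap.mulRight R (gSmul R G Γ g)

theorem exact_endRestrictScalars_groupCommutator :
    Function.Exact (endRestrictScalars R G Γ).toLinearMap (groupCommutator R G Γ) := by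
  intro f
  refine Iff.trans ?_ (mem_range_endRestrictScalars_iff R G Γ f).symm
  rw [funext_iff]
  exact forall_congr' fun g => sub_eq_zero

theorem gSmul_baseChange (g : G) :
    gSmul D G (D ⊗[R] Γ) g = (gSmul R G Γ g).baseChange D := by
  show (gBaseChange R G D Γ).asAlgebraHom (MonoidAlgebra.of D G g) = _
  rw [Representation.asAlgebraHom_of]
  rfl

theorem LinearMap.tensorProductEnd_tmul (M : Type) [AddCommGroup M] [Module R M]
    (d : D) (f : Module.End R M) :
    LinearMap.tensorProductEnd R D M (d ⊗ₜ f) = d • f.baseChange D := rfl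

theorem LinearMap.tensorProductEnd_bijective (M : Type) [AddCommGroup M] [Module R M]
    [Module.Free R M] [Module.Finite R M] [Module.Flat R D] :
    Function.Bijective (LinearMap.tensorProductEnd R D M) := by
  have := Module.finitePresentation_of_projective R M
  have h : ⇑(LinearMap.tensorProductEnd R D M) =
      (Module.FinitePresentation.isBaseChange_map R M M D).equiv := by
    ext1 x
    induction x using TensorProduct.induction_on with
    | zero => simp
    | add x y hx hy => simp only [map_add, hx, hy]
    | tmul d f =>
      rw [LinearMap.tensorProductEnd_tmul, IsBaseChange.equiv_tmul, LinearMap.baseChangeHom_apply]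
  rw [h]
  exact LinearEquiv.bijective _

/-- Base change of `R[G]`-linear endomorphisms, as `D`-linear endomorphisms. -/
noncomputable def endBaseChange :
    D ⊗[R] Module.End (MonoidAlgebra R G) Γ →ₐ[D] Module.End D (D ⊗[R] Γ) :=
  (LinearMap.tensorProductEnd R D Γ).comp
    (Algebra.TensorProduct.map (AlgHom.id D D) (endRestrictScalars R G Γ))

theorem endBaseChange_apply (x : D ⊗[R] Module.End (MonoidAlgebra R G) Γ) :
    endBaseChange R G D Γ x = LinearMap.tensorProductEnd R D Γ
      ((endRestrictScalars R G Γ).toLinearMap.lTensor D x) := rfl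

theorem tensorProductEnd_groupCommutator (g : G) (x : D ⊗[R] Module.End R Γ) :
    LinearMap.tensorProductEnd R D Γ
        (TensorProduct.piRightHom R D D (fun _ : G => Module.End R Γ)
          ((groupCommutator R G Γ).lTensor D x) g) =
      gSmul D G (D ⊗[R] Γ) g * LinearMap.tensorProductEnd R D Γ x -
        LinearMap.tensorProductEnd R D Γ x * gSmul D G (D ⊗[R] Γ) g := by
  induction x using TensorProduct.induction_on with
  | zero =>
    simp only [map_zero, Pi.zero_apply, mul_zero, zero_mul]
    exact (sub_self (0 : Module.End D (D ⊗[R] Γ))).symm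
  | add x y hx hy =>
    simp only [map_add, Pi.add_apply, hx, hy]
    noncomm_ring
  | tmul d f =>
    have h : groupCommutator R G Γ f g = gSmul R G Γ g * f - f * gSmul R G Γ g := rfl
    rw [gSmul_baseChange, LinearMap.lTensor_tmul, TensorProduct.piRightHom_tmul]
    beta_reduce
    rw [h,
      LinearMap.tensorProductEnd_tmul, LinearMap.tensorProductEnd_tmul, LinearMap.baseChange_sub,
      LinearMap.baseChange_mul, LinearMap.baseChange_mul, mul_smul_comm, smul_mul_assoc]
    exact smul_sub (A := Module.End D (D ⊗[R] Γ)) d _ _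

variable [Module.Free R Γ] [Module.Finite R Γ]

theorem endBaseChange_injective [Module.Flat R D] :
    Function.Injective (endBaseChange R G D Γ) :=
  (LinearMap.tensorProductEnd_bijective R D Γ).1.comp
    (Module.Flat.lTensor_preserves_injective_linearMap _ (endRestrictScalars_injective R G Γ))

theorem range_endBaseChange [Finite G] [Module.Flat R D] :
    (endBaseChange R G D Γ).range = (endRestrictScalars D G (D ⊗[R] Γ)).range := by
  classical
  have := Fintype.ofFinite G
  ext f
  obtain ⟨x, rfl⟩ := (LinearMap.tensorProductEnd_bijective R D Γ).2 f
  rw [mem_range_endRestrictScalars_iff]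
  have hexact := Module.Flat.lTensor_exact D (exact_endRestrictScalars_groupCommutator R G Γ) x
  have hinj := (LinearMap.tensorProductEnd_bijective R D Γ).1
  trans (groupCommutator R G Γ).lTensor D x = 0
  · rw [hexact]
    exact exists_congr fun y => hinj.eq_iff
  · rw [← (TensorProduct.piRight R D D fun _ : G => Module.End R Γ).map_eq_zero_iff,
      TensorProduct.piRight_apply, funext_iff]
    refine forall_congr' fun g => ?_
    rw [Pi.zero_apply, ← map_eq_zero_iff _ hinj, tensorProductEnd_groupCommutator]
    exact sub_eq_zero (a := gSmul D G (D ⊗[R] Γ) g * LinearMap.tensorProductEnd R D Γ x)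

/-- For a field `D` flat over `R`, forming the `R[G]`-linear endomorphism ring of a finite free
`R`-module commutes with base change to `D`. -/
noncomputable def endTensorEquiv [Finite G] [Module.Flat R D] :
    Module.End (MonoidAlgebra R G) Γ ⊗[R] D ≃+* Module.End (MonoidAlgebra D G) (D ⊗[R] Γ) :=
  (Algebra.TensorProduct.comm R (Module.End (MonoidAlgebra R G) Γ) D).toRingEquiv.trans
    ((AlgEquiv.ofInjective _ (endBaseChange_injective R G D Γ)).trans
      ((Subalgebra.equivOfEq _ _ (range_endBaseChange R G D Γ)).trans
        (AlgEquiv.ofInjective _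
          (endRestrictScalars_injective D G (D ⊗[R] Γ))).symm)).toRingEquiv

end EndBaseChange


/-- Let `R` be a commutative integral domain of characteristic zero, `G` a
finite group, `Γ` an `R[G]`-module which is free of finite rank over `R`, and `D` a field which
is an `R`-algebra via an injective ring homomorphism `R → D`.  Then `End_{R[G]}(Γ) ⊗_R D` is a
division ring (a nonzero ring in which every nonzero element is invertible) if and only if
`Γ ⊗_R D` (written `D ⊗[R] Γ`, with `G` acting on the factor `Γ` and `D` acting on the factor
`D`) is a simple `D[G]`-module. -/
theorem endTensor_divisionRing_iff_baseChange_simple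
    (R : Type) [CommRing R] [IsDomain R] [CharZero R]
    (G : Type) [Group G] [Finite G]
    (D : Type) [Field D] [Algebra R D] (hinj : Function.Injective (algebraMap R D))
    (Γ : Type) [AddCommGroup Γ] [Module R Γ] [Module (MonoidAlgebra R G) Γ]
    [IsScalarTower R (MonoidAlgebra R G) Γ]
    [Module.Free R Γ] [Module.Finite R Γ] :
    (((0 : (Module.End (MonoidAlgebra R G) Γ) ⊗[R] D) ≠ 1) ∧
        ∀ x : (Module.End (MonoidAlgebra R G) Γ) ⊗[R] D, x ≠ 0 → IsUnit x) ↔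
      IsSimpleModule (MonoidAlgebra D G) (D ⊗[R] Γ) := by
  have := Module.Flat.of_injective_algebraMap_field hinj
  have : CharZero D := charZero_of_injective_algebraMap hinj
  have : NeZero (Nat.card G : D) := ⟨Nat.cast_ne_zero.2 Nat.card_pos.ne'⟩
  rw [isSimpleModule_iff_end_isUnit]
  let e := endTensorEquiv R G D Γ
  refine and_congr ?_ (e.forall_congr fun x => ?_)
  · have h : e 0 ≠ e 1 ↔ _ := e.injective.ne_iff
    rwa [map_zero, map_one, Iff.comm] at h
  · exact imp_congr (map_ne_zero_iff e e.injective).symm (MulEquiv.isUnit_map e).symm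
end

section
/- Let $d$ be a positive rational number, and let $K$ be a field that is a $\mathbb{Q}$-algebra of dimension $2$ over $\mathbb{Q}$ and contains an element $s$ with $s^2 = -d$ (so $K \cong \mathbb{Q}(\sqrt{-d})$ is an imaginary quadratic field). Then Hamilton's quaternion algebra $\mathbb{H}_K$ over $K$ (the quaternion algebra over $K$ with $i^2 = j^2 = -1$, $ij = -ji = k$) fails to be a division ring — that is, there exist nonzero $x, y \in \mathbb{H}_K$ with $xy = 0$ — if and only if $d$ is a sum of three squares of rational numbers, i.e. $d = a^2 + b^2 + c^2$ for some $a, b, c \in \mathbb{Q}$. -/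
open Quaternion

/-- A zero divisor in a quaternion algebra over a field has norm zero. -/
theorem normSq_eq_zero_of_mul_eq_zero {K : Type*} [Field K] {x y : ℍ[K]} (hy : y ≠ 0)
    (hxy : x * y = 0) : normSq x = 0 := by
  by_contra hx
  apply hy
  have h : normSq x • y = 0 := by
    rw [← Quaternion.coe_mul_eq_smul, ← Quaternion.star_mul_self, mul_assoc, hxy, mul_zero]
  exact (smul_eq_zero.mp h).resolve_left hx

/-- If `-d < 0` has a square root `s` in an extension of `ℚ`, then `1` and `s` are linearly
independent over `ℚ`. -/
theorem eq_zero_of_add_mul_sqrt_neg_eq_zero {K : Type*} [Field K] [Algebra ℚ K] {d : ℚ}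
    (hd : 0 < d) {s : K} (hs : s ^ 2 = algebraMap ℚ K (-d)) {p q : ℚ}
    (h : algebraMap ℚ K p + algebraMap ℚ K q * s = 0) : p = 0 ∧ q = 0 := by
  have key : algebraMap ℚ K (p ^ 2 + d * q ^ 2) = algebraMap ℚ K 0 := by
    simp only [map_add, map_mul, map_pow, map_neg, map_zero] at hs ⊢
    linear_combination (algebraMap ℚ K p - algebraMap ℚ K q * s) * h +
      algebraMap ℚ K q ^ 2 * hs
  have key' : p ^ 2 + d * q ^ 2 = 0 := (algebraMap ℚ K).injective key
  have hp : p = 0 := by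
    apply pow_eq_zero_iff (two_ne_zero) |>.mp
    nlinarith [sq_nonneg p, mul_nonneg hd.le (sq_nonneg q)]
  subst hp
  simpa [hd.ne'] using key'

/-- A quadratic extension of `ℚ` containing a square root `s` of `-d < 0` is `ℚ + ℚ s`. -/
theorem exists_eq_add_mul_sqrt_neg {K : Type*} [Field K] [Algebra ℚ K]
    (hdim : Module.finrank ℚ K = 2) {d : ℚ} (hd : 0 < d) {s : K}
    (hs : s ^ 2 = algebraMap ℚ K (-d)) (z : K) :
    ∃ p q : ℚ, z = algebraMap ℚ K p + algebraMap ℚ K q * s := by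
  have hli : LinearIndependent ℚ ![(1 : K), s] := by
    rw [LinearIndependent.pair_iff]
    intro p q h
    apply eq_zero_of_add_mul_sqrt_neg_eq_zero hd hs
    simpa [Algebra.smul_def] using h
  have : FiniteDimensional ℚ K := FiniteDimensional.of_finrank_pos (by omega)
  have hspan := hli.span_eq_top_of_card_eq_finrank' (by simp [hdim])
  have hz : z ∈ Submodule.span ℚ (Set.range ![(1 : K), s]) := hspan ▸ Submodule.mem_top
  rw [Matrix.range_cons_cons_empty, Submodule.mem_span_pair] at hz
  obtain ⟨p, q, h⟩ := hz
  exact ⟨p, q, by simpa [Algebra.smul_def] using h.symm⟩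

/-- If orthogonal rational quaternions `P` and `Q ≠ 0` have norms in the ratio `d`, then `d` is a
sum of three rational squares, namely those of the coordinates of `P * star Q / normSq Q`. -/
theorem sum_three_squares_of_normSq_eq_mul {d : ℚ} {P Q : ℍ[ℚ]} (hQ : Q ≠ 0)
    (hnorm : normSq P = d * normSq Q) (horth : (P * star Q).re = 0) :
    ∃ a b c : ℚ, d = a ^ 2 + b ^ 2 + c ^ 2 := by
  have hN : normSq Q ≠ 0 := normSq_ne_zero.mpr hQ
  have h : normSq (P * star Q) = d * normSq Q ^ 2 := by
    rw [map_mul, normSq_star, hnorm]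
    ring
  rw [normSq_def', horth] at h
  refine ⟨(P * star Q).imI / normSq Q, (P * star Q).imJ / normSq Q,
    (P * star Q).imK / normSq Q, ?_⟩
  field_simp
  linear_combination -h

/-- Let `d` be a positive rational number and let `K` be a field which is a
`ℚ`-algebra of dimension `2` over `ℚ` containing an element `s` with `s² = -d` (so
`K ≅ ℚ(√-d)` is an imaginary quadratic field).  Then Hamilton's quaternion algebra `ℍ[K]`
(with `i² = j² = -1`, `ij = -ji = k`) fails to be a division ring — that is, there are nonzero
`x, y ∈ ℍ[K]` with `x * y = 0` — if and only if `d` is a sum of three squares of rational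
numbers. -/
theorem quaternions_over_imaginary_quadratic_split_iff_sum_three_squares
    (d : ℚ) (hd : 0 < d)
    (K : Type) [Field K] [Algebra ℚ K] (hdim : Module.finrank ℚ K = 2)
    (s : K) (hs : s ^ 2 = algebraMap ℚ K (-d)) :
    (∃ x y : ℍ[K], x ≠ 0 ∧ y ≠ 0 ∧ x * y = 0) ↔
      ∃ a b c : ℚ, d = a ^ 2 + b ^ 2 + c ^ 2 := by
  constructor
  · rintro ⟨x, y, hx, hy, hxy⟩
    have hN := normSq_eq_zero_of_mul_eq_zero hy hxy
    obtain ⟨p₀, q₀, h₀⟩ := exists_eq_add_mul_sqrt_neg hdim hd hs x.re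
    obtain ⟨p₁, q₁, h₁⟩ := exists_eq_add_mul_sqrt_neg hdim hd hs x.imI
    obtain ⟨p₂, q₂, h₂⟩ := exists_eq_add_mul_sqrt_neg hdim hd hs x.imJ
    obtain ⟨p₃, q₃, h₃⟩ := exists_eq_add_mul_sqrt_neg hdim hd hs x.imK
    obtain ⟨P, rfl, rfl, rfl, rfl⟩ :
        ∃ P : ℍ[ℚ], P.re = p₀ ∧ P.imI = p₁ ∧ P.imJ = p₂ ∧ P.imK = p₃ :=
      ⟨⟨p₀, p₁, p₂, p₃⟩, rfl, rfl, rfl, rfl⟩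
    obtain ⟨Q, rfl, rfl, rfl, rfl⟩ :
        ∃ Q : ℍ[ℚ], Q.re = q₀ ∧ Q.imI = q₁ ∧ Q.imJ = q₂ ∧ Q.imK = q₃ :=
      ⟨⟨q₀, q₁, q₂, q₃⟩, rfl, rfl, rfl, rfl⟩
    have hPQ : algebraMap ℚ K (normSq P - d * normSq Q) +
        algebraMap ℚ K (2 * (P * star Q).re) * s = 0 := by
      rw [normSq_def', h₀, h₁, h₂, h₃] at hN
      simp only [normSq_def', re_mul, re_star, imI_star, imJ_star, imK_star, map_add,
        map_sub, map_mul, map_pow, map_neg, map_ofNat] at hs ⊢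
      linear_combination hN - (algebraMap ℚ K Q.re ^ 2 + algebraMap ℚ K Q.imI ^ 2 +
        algebraMap ℚ K Q.imJ ^ 2 + algebraMap ℚ K Q.imK ^ 2) * hs
    obtain ⟨hnorm, horth⟩ := eq_zero_of_add_mul_sqrt_neg_eq_zero hd hs hPQ
    refine sum_three_squares_of_normSq_eq_mul (P := P) (Q := Q) (fun hQ => hx ?_)
      (sub_eq_zero.mp hnorm) ((mul_eq_zero.mp horth).resolve_left two_ne_zero)
    have hP : P = 0 := by simpa [hQ] using hnorm
    subst hP hQ
    ext <;> simp [h₀, h₁, h₂, h₃]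
  · rintro ⟨a, b, c, habc⟩
    obtain ⟨x, hre, hI, hJ, hK⟩ : ∃ x : ℍ[K], x.re = s ∧ x.imI = algebraMap ℚ K a ∧
        x.imJ = algebraMap ℚ K b ∧ x.imK = algebraMap ℚ K c :=
      ⟨⟨s, algebraMap ℚ K a, algebraMap ℚ K b, algebraMap ℚ K c⟩, rfl, rfl, rfl, rfl⟩
    have hx : x ≠ 0 := by
      rintro rfl
      rw [← hre, re_zero, zero_pow two_ne_zero, eq_comm,
        map_eq_zero_iff _ (algebraMap ℚ K).injective] at hs
      linarith
    refine ⟨x, star x, hx, star_ne_zero.mpr hx, ?_⟩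
    have hN : normSq x = 0 := by
      simp only [normSq_def', hre, hI, hJ, hK, hs, habc, map_neg, map_add, map_pow]
      ring
    rw [self_mul_star, hN, coe_zero]
end
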